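/- Let E and F be finite-dimensional real inner product spaces with dim E = m ≥ n = dim F ≥ 1, and let Φ : E → F be a Lipschitz map. If p ∈ E is nonsingular for Φ in the sense of Clarke (every g ∈ ∂Φ(p) is surjective), then there exist constants λ > 0 and δ > 0 such that: (1) for every unit vector u ∈ F and every x in the open ball B(p, 2λ) there is a unit vector V ∈ E with ⟪V, g†(u)⟫ ≥ δ for all g ∈ ∂Φ(x); and (2) every point x ∈ B(p, 2λ) is nonsingular for Φ. -/

import Mathlib

open Filter Topology
open scoped RealInnerProductSpace

/-- The mixture of the differential of a Lipschitz map `Φ` at `p`: all operator-norm limits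
of `fderiv ℝ Φ xᵢ` along sequences of differentiability points `xᵢ → p`. -/
def mixture {E F : Type*} [NormedAddCommGroup E] [NormedSpace ℝ E]
    [NormedAddCommGroup F] [NormedSpace ℝ F] (Φ : E → F) (p : E) :
    Set (E →L[ℝ] F) :=
  {G : E →L[ℝ] F | ∃ x : ℕ → E, (∀ i, DifferentiableAt ℝ Φ (x i)) ∧
    Tendsto x atTop (𝓝 p) ∧ Tendsto (fun i => fderiv ℝ Φ (x i)) atTop (𝓝 G)}

/-- The Clarke generalized differential of `Φ` at `p`. -/
def clarke {E F : Type*} [NormedAddCommGroup E] [NormedSpace ℝ E]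
    [NormedAddCommGroup F] [NormedSpace ℝ F] (Φ : E → F) (p : E) :
    Set (E →L[ℝ] F) :=
  convexHull ℝ (mixture Φ p)

/-- In a finite-dimensional space the convex hull of a compact set is compact. -/
theorem isCompact_convexHull_of_finiteDimensional {V : Type*} [NormedAddCommGroup V]
    [NormedSpace ℝ V] [FiniteDimensional ℝ V] {s : Set V} (hs : IsCompact s) :
    IsCompact (convexHull ℝ s) := by
  have key : convexHull ℝ s = ⋃ k ∈ Finset.range (Module.finrank ℝ V + 2),
      (fun q : (Fin k → ℝ) × (Fin k → V) => ∑ i, q.1 i • q.2 i) ''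
        (stdSimplex ℝ (Fin k) ×ˢ Set.univ.pi fun _ => s) := by
    ext x
    simp only [Set.mem_iUnion, Set.mem_image, Finset.mem_range, Prod.exists, Set.mem_prod,
      Set.mem_univ_pi]
    constructor
    · intro hx
      obtain ⟨ι, _, z, w, hz, hind, hw, hw1, rfl⟩ := eq_pos_convex_span_of_mem_convexHull hx
      let e := Fintype.equivFin ι
      have hcard := hind.card_le_finrank_succ
      have hle := Submodule.finrank_le (vectorSpan ℝ (Set.range z))
      refine ⟨Fintype.card ι, by omega, w ∘ e.symm, z ∘ e.symm, ⟨⟨fun i => (hw _).le, ?_⟩, ?_⟩, ?_⟩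
      · rw [← hw1]
        exact e.symm.sum_comp w
      · exact fun i => hz ⟨_, rfl⟩
      · exact e.symm.sum_comp fun i => w i • z i
    · rintro ⟨k, -, w, z, ⟨⟨hw, hw1⟩, hz⟩, rfl⟩
      exact mem_convexHull_of_exists_fintype w z hw hw1 hz rfl
  rw [key]
  refine (Finset.range _).isCompact_biUnion fun k _ => ?_
  exact ((isCompact_stdSimplex ℝ (Fin k)).prod (isCompact_univ_pi fun _ => hs)).image
    (by fun_prop)

section Mixture

variable {E F : Type*} [NormedAddCommGroup E] [NormedSpace ℝ E]
  [NormedAddCommGroup F] [NormedSpace ℝ F] {Φ : E → F} {p : E}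

theorem mem_mixture_iff_clusterPt {G : E →L[ℝ] F} :
    G ∈ mixture Φ p ↔
      ClusterPt G (map (fderiv ℝ Φ) (𝓝 p ⊓ 𝓟 {x | DifferentiableAt ℝ Φ x})) := by
  constructor
  · rintro ⟨x, hd, hx, hG⟩
    have hx' : Tendsto x atTop (𝓝 p ⊓ 𝓟 {x | DifferentiableAt ℝ Φ x}) :=
      tendsto_inf.2 ⟨hx, tendsto_principal.2 (Eventually.of_forall hd)⟩
    exact hG.mapClusterPt.clusterPt.mono (tendsto_map.comp hx')
  · intro h
    obtain ⟨x, hG, hx⟩ := MapClusterPt.exists_seq_tendsto h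
    obtain ⟨hx, hd⟩ := tendsto_inf.1 hx
    obtain ⟨N, hN⟩ := eventually_atTop.1 (tendsto_principal.1 hd)
    exact ⟨fun n => x (n + N), fun n => hN _ (Nat.le_add_left _ _),
      (tendsto_add_atTop_iff_nat N).2 hx, (tendsto_add_atTop_iff_nat N).2 hG⟩

theorem isClosed_mixture : IsClosed (mixture Φ p) := by
  have : mixture Φ p =
      {G | ClusterPt G (map (fderiv ℝ Φ) (𝓝 p ⊓ 𝓟 {x | DifferentiableAt ℝ Φ x}))} :=
    Set.ext fun _ => mem_mixture_iff_clusterPt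
  rw [this]
  exact isClosed_setOfPred_clusterPt

theorem mixture_subset_of_eventually_mem {C : Set (E →L[ℝ] F)} (hC : IsClosed C)
    (h : ∀ᶠ y in 𝓝 p, DifferentiableAt ℝ Φ y → fderiv ℝ Φ y ∈ C) : mixture Φ p ⊆ C := by
  rintro G ⟨x, hd, hx, hG⟩
  exact hC.mem_of_tendsto hG ((hx.eventually h).mono fun n hn => hn (hd n))

theorem LipschitzWith.isCompact_mixture [FiniteDimensional ℝ E] [FiniteDimensional ℝ F]
    {L : NNReal} (hΦ : LipschitzWith L Φ) : IsCompact (mixture Φ p) := by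
  have := FiniteDimensional.proper ℝ (E →L[ℝ] F)
  refine (isCompact_closedBall (0 : E →L[ℝ] F) L).of_isClosed_subset isClosed_mixture ?_
  exact mixture_subset_of_eventually_mem Metric.isClosed_closedBall
    (Eventually.of_forall fun y _ => by
      simpa using norm_fderiv_le_of_lipschitz ℝ hΦ)

/-- The differential of a Lipschitz map is upper semicontinuous: near `p` it takes values in any
given neighbourhood of its mixture at `p`. -/
theorem LipschitzWith.eventually_fderiv_mem [FiniteDimensional ℝ E] [FiniteDimensional ℝ F]
    {L : NNReal} (hΦ : LipschitzWith L Φ) {U : Set (E →L[ℝ] F)} (hU : IsOpen U)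
    (hsub : mixture Φ p ⊆ U) :
    ∀ᶠ y in 𝓝 p, DifferentiableAt ℝ Φ y → fderiv ℝ Φ y ∈ U := by
  have := FiniteDimensional.proper ℝ (E →L[ℝ] F)
  by_contra hne
  obtain ⟨y, hy, hyU⟩ := exists_seq_forall_of_frequently (not_eventually.1 hne)
  push Not at hyU
  obtain ⟨G, -, φ, hφ, hG⟩ := (isCompact_closedBall (0 : E →L[ℝ] F) L).tendsto_subseq
    (x := fun n => fderiv ℝ Φ (y n)) fun n => by simpa using norm_fderiv_le_of_lipschitz ℝ hΦ
  have hGU : G ∈ Uᶜ := hU.isClosed_compl.mem_of_tendsto hG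
    (Eventually.of_forall fun n => (hyU (φ n)).2)
  exact hGU (hsub ⟨y ∘ φ, fun n => (hyU (φ n)).1, hy.comp hφ.tendsto_atTop, hG⟩)

/-- The Clarke differential of a Lipschitz map is upper semicontinuous. -/
theorem LipschitzWith.eventually_clarke_subset_cthickening [FiniteDimensional ℝ E]
    [FiniteDimensional ℝ F] {L : NNReal} (hΦ : LipschitzWith L Φ) {ε : ℝ} (hε : 0 < ε) :
    ∀ᶠ x in 𝓝 p, clarke Φ x ⊆ Metric.cthickening ε (clarke Φ p) := by
  have h := hΦ.eventually_fderiv_mem (p := p) (Metric.isOpen_thickening (δ := ε))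
    ((subset_convexHull ℝ _).trans (Metric.self_subset_thickening hε (clarke Φ p)))
  filter_upwards [h.eventually_nhds] with x hx
  refine convexHull_min (mixture_subset_of_eventually_mem Metric.isClosed_cthickening
    (hx.mono fun y hy hd => Metric.thickening_subset_cthickening _ _ (hy hd))) ?_
  exact (convex_convexHull ℝ _).cthickening _

end Mixture

section InnerProduct

variable {E F : Type*} [NormedAddCommGroup E] [InnerProductSpace ℝ E]
  [NormedAddCommGroup F] [InnerProductSpace ℝ F]

theorem ContinuousLinearMap.surjective_of_adjoint_ne_zero [FiniteDimensional ℝ E]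
    [FiniteDimensional ℝ F] {g : E →L[ℝ] F}
    (h : ∀ u : F, ‖u‖ = 1 → ContinuousLinearMap.adjoint g u ≠ 0) : Function.Surjective g := by
  have hbot : (g : E →ₗ[ℝ] F).rangeᗮ = ⊥ := by
    rw [ContinuousLinearMap.orthogonal_range, Submodule.eq_bot_iff]
    intro u hu
    by_contra hu0
    refine h ((‖u‖⁻¹ : ℝ) • u) (norm_smul_inv_norm (𝕜 := ℝ) hu0) ?_
    have hu' : ContinuousLinearMap.adjoint g u = 0 := hu
    rw [map_smul, hu', smul_zero]
  exact LinearMap.range_eq_top.1 (Submodule.orthogonal_eq_bot_iff.1 hbot)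

theorem ContinuousLinearMap.adjoint_apply_ne_zero_of_surjective [CompleteSpace E]
    [CompleteSpace F] {g : E →L[ℝ] F} (hg : Function.Surjective g) {u : F} (hu : u ≠ 0) :
    ContinuousLinearMap.adjoint g u ≠ 0 := by
  intro h0
  obtain ⟨v, hv⟩ := hg u
  have := ContinuousLinearMap.adjoint_inner_right g v u
  rw [h0, hv, inner_zero_right] at this
  exact hu (inner_self_eq_zero.1 this.symm)

/-- A complete convex set at distance at least `δ > 0` from the origin lies in a half-space at
distance `δ` from the origin. -/
theorem Convex.exists_unit_le_inner {K : Set E} (hK : Convex ℝ K) (hc : IsComplete K)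
    (hne : K.Nonempty) {δ : ℝ} (hδ : 0 < δ) (hKδ : ∀ x ∈ K, δ ≤ ‖x‖) :
    ∃ V : E, ‖V‖ = 1 ∧ ∀ x ∈ K, δ ≤ ⟪V, x⟫ := by
  obtain ⟨w, hw, hmin⟩ := exists_norm_eq_iInf_of_complete_convex hne hc hK 0
  rw [norm_eq_iInf_iff_real_inner_le_zero hK hw] at hmin
  have hwpos : 0 < ‖w‖ := hδ.trans_le (hKδ w hw)
  refine ⟨(‖w‖⁻¹ : ℝ) • w, norm_smul_inv_norm (𝕜 := ℝ) (norm_pos_iff.1 hwpos), fun x hx => ?_⟩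
  have h := hmin x hx
  rw [zero_sub, inner_neg_left, inner_sub_right, real_inner_self_eq_norm_sq] at h
  rw [real_inner_smul_left]
  refine (hKδ w hw).trans ?_
  rw [inv_mul_eq_div, le_div_iff₀ hwpos]
  linarith

/-- The adjoints of a compact convex set of surjective maps are uniformly transverse: each unit
vector `u` admits a common direction `V` with `⟪V, c† u⟫ ≥ δ`. -/
theorem exists_uniform_unit_le_inner_adjoint [FiniteDimensional ℝ E] [FiniteDimensional ℝ F]
    [Nontrivial E] {C : Set (E →L[ℝ] F)} (hconv : Convex ℝ C) (hcomp : IsCompact C)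
    (hsurj : ∀ g ∈ C, Function.Surjective g) :
    ∃ δ > (0 : ℝ), ∀ u : F, ‖u‖ = 1 → ∃ V : E, ‖V‖ = 1 ∧
      ∀ g ∈ C, δ ≤ ⟪V, ContinuousLinearMap.adjoint g u⟫ := by
  rcases C.eq_empty_or_nonempty with rfl | hne
  · obtain ⟨V, hV⟩ := exists_norm_eq E zero_le_one
    exact ⟨1, one_pos, fun u _ => ⟨V, hV, by simp⟩⟩
  have hcont : Continuous fun q : (E →L[ℝ] F) × F =>
      ‖ContinuousLinearMap.adjoint q.1 q.2‖ := by fun_prop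
  obtain ⟨δ, hδ, hle⟩ := (hcomp.prod (isCompact_sphere (0 : F) 1)).exists_forall_le'
    hcont.continuousOn (a := 0) fun q hq => norm_pos_iff.2 <|
      ContinuousLinearMap.adjoint_apply_ne_zero_of_surjective (hsurj _ hq.1)
        (ne_zero_of_mem_unit_sphere ⟨q.2, hq.2⟩)
  refine ⟨δ, hδ, fun u hu => ?_⟩
  let A : (E →L[ℝ] F) →ₗ[ℝ] E :=
    { toFun := fun g => ContinuousLinearMap.adjoint g u
      map_add' := fun g h => by simp
      map_smul' := fun r g => by simp }
  have hA : Continuous A := A.continuous_of_finiteDimensional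
  obtain ⟨V, hV, hVK⟩ := (hconv.linear_image A).exists_unit_le_inner
    (hcomp.image hA).isComplete (hne.image A) hδ
    (Set.forall_mem_image.2 fun g hg => hle (g, u) ⟨hg, by simpa using hu⟩)
  exact ⟨V, hV, fun g hg => hVK _ ⟨g, hg, rfl⟩⟩

theorem ContinuousLinearMap.inner_adjoint_sub_le [CompleteSpace E] [CompleteSpace F]
    (g c : E →L[ℝ] F) {u : F} {V : E} (hu : ‖u‖ = 1) (hV : ‖V‖ = 1) :
    ⟪V, ContinuousLinearMap.adjoint c u⟫ - ‖g - c‖ ≤ ⟪V, ContinuousLinearMap.adjoint g u⟫ := by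
  rw [ContinuousLinearMap.adjoint_inner_right, ContinuousLinearMap.adjoint_inner_right,
    sub_le_comm, ← inner_sub_left]
  calc ⟪c V - g V, u⟫ ≤ ‖c V - g V‖ * ‖u‖ := real_inner_le_norm _ _
    _ = ‖(g - c) V‖ := by rw [hu, mul_one, norm_sub_rev]; rfl
    _ ≤ ‖g - c‖ := by simpa [hV] using (g - c).le_opNorm V

end InnerProduct

theorem stmt_9 {E F : Type*}
    [NormedAddCommGroup E] [InnerProductSpace ℝ E] [FiniteDimensional ℝ E]
    [NormedAddCommGroup F] [InnerProductSpace ℝ F] [FiniteDimensional ℝ F]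
    (hn : 1 ≤ Module.finrank ℝ F) (hmn : Module.finrank ℝ F ≤ Module.finrank ℝ E)
    (Φ : E → F) (L : NNReal) (hΦ : LipschitzWith L Φ) (p : E)
    (hp : ∀ g ∈ clarke Φ p, Function.Surjective g) :
    ∃ lam > (0 : ℝ), ∃ δ > (0 : ℝ),
      (∀ u : F, ‖u‖ = 1 → ∀ x ∈ Metric.ball p (2 * lam), ∃ V : E, ‖V‖ = 1 ∧
        ∀ g ∈ clarke Φ x, δ ≤ ⟪V, ContinuousLinearMap.adjoint g u⟫) ∧
      (∀ x ∈ Metric.ball p (2 * lam), ∀ g ∈ clarke Φ x, Function.Surjective g) := by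
  have : Nontrivial E := Module.nontrivial_of_finrank_pos (R := ℝ) (hn.trans hmn)
  have hcomp : IsCompact (clarke Φ p) :=
    isCompact_convexHull_of_finiteDimensional hΦ.isCompact_mixture
  obtain ⟨δ, hδ, hV⟩ := exists_uniform_unit_le_inner_adjoint (convex_convexHull ℝ _) hcomp hp
  obtain ⟨r, hr, hball⟩ := Metric.eventually_nhds_iff_ball.1
    (hΦ.eventually_clarke_subset_cthickening (p := p) (half_pos hδ))
  have hmain : ∀ u : F, ‖u‖ = 1 → ∀ x ∈ Metric.ball p (2 * (r / 2)), ∃ V : E, ‖V‖ = 1 ∧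
      ∀ g ∈ clarke Φ x, δ / 2 ≤ ⟪V, ContinuousLinearMap.adjoint g u⟫ := by
    intro u hu x hx
    obtain ⟨V, hV1, hVC⟩ := hV u hu
    refine ⟨V, hV1, fun g hg => ?_⟩
    have hg' := hball x (by rwa [mul_div_cancel₀ r two_ne_zero] at hx) hg
    rw [hcomp.cthickening_eq_biUnion_closedBall (half_pos hδ).le] at hg'
    obtain ⟨c, hc, hgc⟩ := Set.mem_iUnion₂.1 hg'
    rw [mem_closedBall_iff_norm] at hgc
    have h1 := hVC c hc
    have h2 := ContinuousLinearMap.inner_adjoint_sub_le g c hu hV1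
    linarith
  refine ⟨r / 2, half_pos hr, δ / 2, half_pos hδ, hmain, fun x hx g hg => ?_⟩
  refine ContinuousLinearMap.surjective_of_adjoint_ne_zero fun u hu h0 => ?_
  obtain ⟨V, -, hVg⟩ := hmain u hu x hx
  have h := hVg g hg
  rw [h0, inner_zero_right] at h
  linarith
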